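/- arXiv:2510.19141 — 10 statements merged into one kernel-verified Lean document; each statement's English description precedes it below -/
import Mathlib

section
/- For all natural numbers t, i, j, the falling factorials satisfy (t)_i · (t)_j = ∑_{k=0}^{min(i,j)} C(i,k) · C(j,k) · k! · (t)_{i+j−k}. -/
/-- Vandermonde's identity for falling factorials. -/
theorem add_descFactorial_eq_sum (m n j : ℕ) :
    (m + n).descFactorial j =
      ∑ k ∈ Finset.range (j + 1),
        m.choose k * j.choose k * k.factorial * n.descFactorial (j - k) := by
  rw [Nat.descFactorial_eq_factorial_mul_choose, Nat.add_choose_eq,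
    Finset.Nat.sum_antidiagonal_eq_sum_range_succ_mk, Finset.mul_sum]
  refine Finset.sum_congr rfl fun k hk => ?_
  have hkj : k ≤ j := Nat.lt_succ_iff.mp (Finset.mem_range.mp hk)
  rw [Nat.descFactorial_eq_factorial_mul_choose, ← Nat.choose_mul_factorial_mul_factorial hkj]
  ring

/-- Falling factorial product identity:
`(t)_i (t)_j = ∑_{k=0}^{min(i,j)} C(i,k) C(j,k) k! (t)_{i+j-k}`. -/
theorem descFactorial_mul_descFactorial (t i j : ℕ) :
    t.descFactorial i * t.descFactorial j =
      ∑ k ∈ Finset.range (min i j + 1),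
        i.choose k * j.choose k * k.factorial * t.descFactorial (i + j - k) := by
  have hrange : Finset.range (min i j + 1) ⊆ Finset.range (j + 1) :=
    Finset.range_subset_range.mpr (by omega)
  rw [Finset.sum_subset hrange fun k hk hk' => by
    have hik : i < k := by
      simp only [Finset.mem_range] at hk hk'
      omega
    simp [Nat.choose_eq_zero_of_lt hik]]
  rcases lt_or_ge t i with hti | hit
  · rw [Nat.descFactorial_of_lt hti, zero_mul]
    refine (Finset.sum_eq_zero fun k hk => ?_).symm
    rw [Finset.mem_range] at hk
    rw [Nat.descFactorial_of_lt (by omega : t < i + j - k), mul_zero]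
  · obtain ⟨n, rfl⟩ := Nat.exists_eq_add_of_le hit
    rw [add_descFactorial_eq_sum i n j, Finset.mul_sum]
    refine Finset.sum_congr rfl fun k hk => ?_
    rw [Finset.mem_range] at hk
    rw [← Nat.descFactorial_mul_descFactorial (n := i + n) (by omega : i ≤ i + j - k),
      Nat.add_sub_cancel_left, show i + j - k - i = j - k by omega]
    ring
end

section
/- Let m ≥ 1 be a natural number and define the real m×m matrices L and M, indexed by i, j ∈ {0,…,m−1}, by L_{ij} = C(i,j) and M_{ij} = C(i+j, i). Then: (a) L·Lᵀ = M; (b) det M = 1; (c) M is symmetric positive definite. -/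
theorem Nat.sum_range_choose_mul_choose {a n : ℕ} (b : ℕ) (h : a < n) :
    ∑ k ∈ Finset.range n, a.choose k * b.choose k = (a + b).choose a := by
  rw [add_comm a b, Nat.add_choose_eq, Finset.Nat.sum_antidiagonal_eq_sum_range_succ_mk]
  symm
  refine Finset.sum_subset_zero_on_sdiff (Finset.range_mono h) (fun k hk => ?_) (fun k hk => ?_)
  · simp only [Finset.mem_sdiff, Finset.mem_range] at hk
    rw [Nat.choose_eq_zero_of_lt (by omega), zero_mul]
  · rw [Nat.choose_symm (by simpa [Nat.lt_succ_iff] using hk), mul_comm]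

/-- The Pascal-type matrices `L_{ij} = C(i,j)` and `M_{ij} = C(i+j,i)` satisfy
`L Lᵀ = M`, `det M = 1`, and `M` is symmetric positive definite. -/
theorem pascal_matrix_props (m : ℕ) (hm : 1 ≤ m)
    (L M : Matrix (Fin m) (Fin m) ℝ)
    (hL : ∀ i j : Fin m, L i j = ((i : ℕ).choose (j : ℕ) : ℝ))
    (hM : ∀ i j : Fin m, M i j = (((i : ℕ) + (j : ℕ)).choose (i : ℕ) : ℝ)) :
    L * L.transpose = M ∧ M.det = 1 ∧ M.PosDef := by
  have hmul : L * L.transpose = M := by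
    ext i j
    simp only [Matrix.mul_apply, Matrix.transpose_apply, hL, hM]
    rw [← Nat.sum_range_choose_mul_choose (j : ℕ) i.isLt,
      Fin.sum_univ_eq_sum_range (fun k => ((i : ℕ).choose k * (j : ℕ).choose k : ℝ)) m]
    push_cast
    rfl
  have hdet : L.det = 1 := by
    rw [Matrix.det_of_isLowerTriangular]
    · simp [hL]
    · intro i j hij
      rw [hL, Nat.choose_eq_zero_of_lt (by simpa using hij), Nat.cast_zero]
  refine ⟨hmul, by rw [← hmul, Matrix.det_mul, Matrix.det_transpose, hdet, one_mul], ?_⟩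
  rw [← hmul, ← Matrix.conjTranspose_eq_transpose_of_trivial]
  exact Matrix.PosDef.mul_conjTranspose_self L
    (Matrix.vecMul_injective_iff_isUnit.2 ((Matrix.isUnit_iff_isUnit_det L).2 (by simp [hdet])))
end

section
/- For every natural number m ≥ 1 and every real r with 0 < r < 1, the matrix S(r) is symmetric positive definite. -/
/-- The matrix `S(r)` with entries
`S(r)_{ij} = r^{-(i+j)} ∑_{t=0}^∞ C(t,i) C(t,j) r^{2t}`. -/
noncomputable def Smat (m : ℕ) (r : ℝ) : Matrix (Fin m) (Fin m) ℝ :=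
  fun i j =>
    (∑' t : ℕ, ((t.choose (i : ℕ) : ℝ) * (t.choose (j : ℕ) : ℝ)) * r ^ (2 * t)) /
      r ^ ((i : ℕ) + (j : ℕ))

theorem summable_choose_mul_choose_mul_geometric (i j : ℕ) {r : ℝ} (hr0 : 0 ≤ r) (hr1 : r < 1) :
    Summable fun t : ℕ => ((t.choose i : ℝ) * (t.choose j : ℝ)) * r ^ (2 * t) := by
  have hs : ‖r ^ 2‖ < 1 := by
    rw [Real.norm_of_nonneg (by positivity)]
    exact pow_lt_one₀ hr0 hr1 two_ne_zero
  refine Summable.of_nonneg_of_le (fun t => by positivity) (fun t => ?_)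
    (summable_pow_mul_geometric_of_norm_lt_one (i + j) hs)
  rw [pow_mul, pow_add]
  gcongr
  · exact_mod_cast Nat.choose_le_pow t i
  · exact_mod_cast Nat.choose_le_pow t j

/-- The quadratic form of `Smat m r` is a weighted sum of squares. -/
theorem hasSum_Smat_quadraticForm (m : ℕ) {r : ℝ} (hr0 : 0 < r) (hr1 : r < 1) (x : Fin m → ℝ) :
    HasSum (fun t : ℕ => (∑ i : Fin m, x i * (t.choose i / r ^ (i : ℕ))) ^ 2 * r ^ (2 * t))
      (x ⬝ᵥ Matrix.mulVec (Smat m r) x) := by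
  have h : HasSum (fun t : ℕ => ∑ i : Fin m, ∑ j : Fin m,
      x i * (((t.choose i : ℝ) * (t.choose j : ℝ)) * r ^ (2 * t) / r ^ ((i : ℕ) + (j : ℕ)) * x j))
      (∑ i : Fin m, ∑ j : Fin m, x i * (Smat m r i j * x j)) :=
    hasSum_sum fun i _ => hasSum_sum fun j _ =>
      ((((summable_choose_mul_choose_mul_geometric i j hr0.le hr1).hasSum).div_const _).mul_right
        _).mul_left _
  convert! h using 1
  · funext t
    rw [sq, Finset.sum_mul_sum, Finset.sum_mul]
    refine Finset.sum_congr rfl fun i _ => ?_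
    rw [Finset.sum_mul]
    refine Finset.sum_congr rfl fun j _ => ?_
    rw [pow_add]
    field_simp
  · simp only [dotProduct, Matrix.mulVec, Finset.mul_sum]

theorem eq_zero_of_forall_sum_mul_choose_eq_zero {m : ℕ} {r : ℝ} (hr : r ≠ 0) {x : Fin m → ℝ}
    (h : ∀ t : ℕ, ∑ i : Fin m, x i * (t.choose i / r ^ (i : ℕ)) = 0) : x = 0 := by
  funext i
  induction i using WellFoundedLT.induction with
  | ind i ih =>
    have hi := h i
    rw [Finset.sum_eq_single i] at hi
    · simpa [hr] using hi
    · intro j _ hj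
      rcases lt_or_gt_of_ne hj with hlt | hgt
      · simp [ih j hlt]
      · simp [Nat.choose_eq_zero_of_lt (Fin.lt_def.mp hgt)]
    · simp

/-- For every `m ≥ 1` and `0 < r < 1`, the matrix `S(r)` is symmetric positive
definite. -/
theorem Smat_posDef (m : ℕ) (hm : 1 ≤ m) (r : ℝ) (hr0 : 0 < r) (hr1 : r < 1) :
    (Smat m r).PosDef := by
  refine Matrix.PosDef.of_dotProduct_mulVec_pos ?_ fun x hx => ?_
  · ext i j
    simp only [Smat, Matrix.conjTranspose_apply, star_trivial, add_comm (j : ℕ),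
      mul_comm ((_ : ℕ).choose (j : ℕ) : ℝ)]
  · rw [star_trivial]
    have hsum := hasSum_Smat_quadraticForm m hr0 hr1 x
    obtain ⟨t, ht⟩ : ∃ t : ℕ, ∑ i : Fin m, x i * (t.choose i / r ^ (i : ℕ)) ≠ 0 := by
      by_contra! h
      exact hx (eq_zero_of_forall_sum_mul_choose_eq_zero hr0.ne' h)
    rw [← hsum.tsum_eq]
    exact hsum.summable.tsum_pos (fun t => by positivity) t (by positivity)
end

section
/- For all natural numbers i, j, the one-sided limit as r → 1⁻ of (1−r²)^{i+j+1} · ∑_{t=0}^∞ C(t,i) C(t,j) r^{2t} exists and equals C(i+j, i). -/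
open Filter Topology

theorem Nat.choose_mul_choose_eq_sum_antidiagonal (t i j : ℕ) :
    t.choose i * t.choose j =
      ∑ p ∈ Finset.HasAntidiagonal.antidiagonal j,
        (i + p.2).choose i * i.choose p.1 * t.choose (i + p.2) := by
  rcases lt_or_ge t i with h | h
  · rw [Nat.choose_eq_zero_of_lt h, zero_mul]
    refine (Finset.sum_eq_zero fun p _ => ?_).symm
    rw [Nat.choose_eq_zero_of_lt (by omega : t < i + p.2), mul_zero]
  · have vandermonde := Nat.add_choose_eq i (t - i) j
    rw [Nat.add_sub_cancel' h] at vandermonde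
    rw [vandermonde, Finset.mul_sum]
    refine Finset.sum_congr rfl fun p _ => ?_
    have key := Nat.choose_mul (n := t) (k := i + p.2) (s := i) (Nat.le_add_right _ _)
    rw [Nat.add_sub_cancel_left] at key
    calc t.choose i * (i.choose p.1 * (t - i).choose p.2)
        = i.choose p.1 * (t.choose i * (t - i).choose p.2) := by ring
      _ = (i + p.2).choose i * i.choose p.1 * t.choose (i + p.2) := by rw [← key]; ring

theorem hasSum_choose_mul_pow {x : ℝ} (hx : ‖x‖ < 1) (n : ℕ) :
    HasSum (fun t : ℕ => (t.choose n : ℝ) * x ^ t) (x ^ n / (1 - x) ^ (n + 1)) := by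
  rw [← (add_left_injective n).hasSum_iff]
  · convert! (hasSum_choose_mul_geometric_of_norm_lt_one n hx).mul_left (x ^ n) using 1
    · ext t
      simp only [Function.comp_apply, pow_add]
      ring
    · ring
  · intro t ht
    have htn : t < n := by
      by_contra! h
      exact ht ⟨t - n, Nat.sub_add_cancel h⟩
    simp [Nat.choose_eq_zero_of_lt htn]

theorem one_sub_pow_mul_tsum_choose_mul_choose {x : ℝ} (hx : ‖x‖ < 1) (i j : ℕ) :
    (1 - x) ^ (i + j + 1) * ∑' t : ℕ, (t.choose i : ℝ) * (t.choose j : ℝ) * x ^ t =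
      ∑ p ∈ Finset.HasAntidiagonal.antidiagonal j,
        ((i + p.2).choose i : ℝ) * (i.choose p.1 : ℝ) * x ^ (i + p.2) * (1 - x) ^ p.1 := by
  have hsum : HasSum (fun t : ℕ => (t.choose i : ℝ) * (t.choose j : ℝ) * x ^ t)
      (∑ p ∈ Finset.HasAntidiagonal.antidiagonal j,
        ((i + p.2).choose i : ℝ) * (i.choose p.1 : ℝ) *
          (x ^ (i + p.2) / (1 - x) ^ (i + p.2 + 1))) := by
    convert! hasSum_sum fun (p : ℕ × ℕ) (_ : p ∈ Finset.HasAntidiagonal.antidiagonal j) =>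
      (hasSum_choose_mul_pow hx (i + p.2)).mul_left
        (((i + p.2).choose i : ℝ) * (i.choose p.1 : ℝ)) using 1
    ext t
    have h := congrArg (Nat.cast (R := ℝ)) (Nat.choose_mul_choose_eq_sum_antidiagonal t i j)
    push_cast at h
    rw [h, Finset.sum_mul]
    exact Finset.sum_congr rfl fun p _ => by ring
  have hx1 : 1 - x ≠ 0 := by
    have := (le_abs_self x).trans_lt hx
    linarith
  rw [hsum.tsum_eq, Finset.mul_sum]
  refine Finset.sum_congr rfl fun p hp => ?_
  rw [← Finset.HasAntidiagonal.mem_antidiagonal.mp hp,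
    show i + (p.1 + p.2) + 1 = p.1 + (i + p.2 + 1) by ring, pow_add _ p.1]
  field_simp

/-- As `r → 1⁻` (within `(0,1)`),
`(1-r²)^{i+j+1} ∑_{t=0}^∞ C(t,i) C(t,j) r^{2t} → C(i+j, i)`. -/
theorem tendsto_one_sub_sq_pow_mul_tsum (i j : ℕ) :
    Tendsto
      (fun r : ℝ =>
        (1 - r ^ 2) ^ (i + j + 1) *
          ∑' t : ℕ, (t.choose i : ℝ) * (t.choose j : ℝ) * r ^ (2 * t))
      (nhdsWithin 1 (Set.Ioo (0 : ℝ) 1))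
      (nhds ((i + j).choose i : ℝ)) := by
  have hcont : Continuous fun r : ℝ => ∑ p ∈ Finset.HasAntidiagonal.antidiagonal j,
      ((i + p.2).choose i : ℝ) * (i.choose p.1 : ℝ) * (r ^ 2) ^ (i + p.2) *
        (1 - r ^ 2) ^ p.1 := by
    fun_prop
  have hlim := (hcont.tendsto 1).mono_left (nhdsWithin_le_nhds (s := Set.Ioo (0 : ℝ) 1))
  have hval : ∑ p ∈ Finset.HasAntidiagonal.antidiagonal j,
      ((i + p.2).choose i : ℝ) * (i.choose p.1 : ℝ) *
      ((1 : ℝ) ^ 2) ^ (i + p.2) * (1 - (1 : ℝ) ^ 2) ^ p.1 = ((i + j).choose i : ℝ) := by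
    rw [Finset.sum_eq_single (0, j)]
    · simp
    · rintro ⟨a, b⟩ hp hne
      have ha : a ≠ 0 := by
        rintro rfl
        simp_all
      simp [ha]
    · simp
  rw [hval] at hlim
  refine hlim.congr' ?_
  filter_upwards [self_mem_nhdsWithin] with r hr
  have hr2 : ‖r ^ 2‖ < 1 := by
    rw [Real.norm_of_nonneg (sq_nonneg r)]
    exact pow_lt_one₀ hr.1.le hr.2 two_ne_zero
  simp_rw [pow_mul]
  exact (one_sub_pow_mul_tsum_choose_mul_choose hr2 i j).symm
end

section
/- For every natural number m ≥ 1 and every k ∈ {0,…,m−1}, there exist a constant c > 0 and r₀ ∈ (0,1) such that for all r ∈ (r₀, 1), the (k,k) diagonal entry of S(r)⁻¹ satisfies (S(r)⁻¹)_{kk} ≤ (1−r²)^{2k+1} / c. -/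
open Finset in
theorem sum_choose_mul_choose_succ_succ {R : Type*} [CommRing R] (y : R) {N i j : ℕ}
    (hi : i + 1 < N) :
    ∑ n ∈ range N, ((i + 1).choose n * (j + 1).choose n : R) * y ^ n =
      (y - 1) * ∑ n ∈ range N, (i.choose n * j.choose n : R) * y ^ n +
        ∑ n ∈ range N, (i.choose n * (j + 1).choose n : R) * y ^ n +
        ∑ n ∈ range N, ((i + 1).choose n * j.choose n : R) * y ^ n := by
  obtain ⟨M, rfl⟩ : ∃ M, N = M + 1 := ⟨N - 1, by omega⟩
  have hy : y * ∑ n ∈ range (M + 1), (i.choose n * j.choose n : R) * y ^ n =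
      ∑ n ∈ range M, (i.choose n * j.choose n : R) * y ^ (n + 1) := by
    rw [sum_range_succ, Nat.choose_eq_zero_of_lt (by omega : i < M)]
    simp only [Nat.cast_zero, zero_mul, add_zero, mul_sum]
    exact sum_congr rfl fun n _ => by ring
  rw [sub_mul, hy, one_mul]
  simp only [sum_range_succ' _ M, Nat.choose_succ_succ, Nat.choose_zero_right, Nat.cast_add]
  have : ∀ n, ((i.choose n + i.choose (n + 1) : R) * (j.choose n + j.choose (n + 1))) * y ^ (n + 1)
      = (i.choose n * j.choose n : R) * y ^ (n + 1)
        - (i.choose (n + 1) * j.choose (n + 1) : R) * y ^ (n + 1)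
        + (i.choose (n + 1) * (j.choose n + j.choose (n + 1)) : R) * y ^ (n + 1)
        + ((i.choose n + i.choose (n + 1)) * j.choose (n + 1) : R) * y ^ (n + 1) :=
    fun n => by ring
  simp only [this, sum_add_distrib, sum_sub_distrib]
  ring

theorem summable_choose_mul_choose_mul_pow {x : ℝ} (hx : 0 ≤ x) (hx1 : x < 1) (i j : ℕ) :
    Summable fun t : ℕ => (t.choose i * t.choose j : ℝ) * x ^ t := by
  refine Summable.of_nonneg_of_le (fun t => by positivity) (fun t => ?_)
    (summable_pow_mul_geometric_of_norm_lt_one (i + j)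
      (by rwa [Real.norm_of_nonneg hx] : ‖x‖ < 1))
  rw [pow_add]
  gcongr <;> exact_mod_cast Nat.choose_le_pow _ _

theorem tsum_choose_mul_choose_mul_pow {x : ℝ} (hx : 0 < x) (hx1 : x < 1) (N i j : ℕ)
    (hi : i < N) (hj : j < N) :
    ∑' t : ℕ, (t.choose i * t.choose j : ℝ) * x ^ t =
      (x / (1 - x)) ^ (i + j) / (1 - x) *
        ∑ n ∈ Finset.range N, (i.choose n * j.choose n : ℝ) * (x⁻¹) ^ n := by
  have h1x : 1 - x ≠ 0 := by linarith
  have hs := summable_choose_mul_choose_mul_pow hx.le hx1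
  have split : ∀ i j, ∑' t : ℕ, (t.choose i * t.choose j : ℝ) * x ^ t =
      (Nat.choose 0 i * Nat.choose 0 j : ℝ) +
        ∑' t : ℕ, ((t + 1).choose i * (t + 1).choose j : ℝ) * x ^ (t + 1) := fun i j => by
    rw [(hs i j).tsum_eq_zero_add]; simp
  have zero_right : ∀ i, ∑' t : ℕ, (t.choose i * t.choose 0 : ℝ) * x ^ t =
      (x / (1 - x)) ^ i / (1 - x) := by
    intro i
    induction i with
    | zero => simp [tsum_geometric_of_lt_one hx.le hx1]
    | succ i ih =>
      have h := split (i + 1) 0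
      have e : ∀ t : ℕ, ((t + 1).choose (i + 1) * (t + 1).choose 0 : ℝ) * x ^ (t + 1) =
          x * ((t.choose i * t.choose 0 : ℝ) * x ^ t) +
            x * ((t.choose (i + 1) * t.choose 0 : ℝ) * x ^ t) := fun t => by
        simp only [Nat.choose_succ_succ, Nat.choose_zero_right]; push_cast; ring
      simp only [e] at h
      rw [((hs i 0).mul_left x).tsum_add ((hs (i + 1) 0).mul_left x), tsum_mul_left,
        tsum_mul_left, ih, Nat.choose_zero_succ] at h
      generalize ∑' t : ℕ, (t.choose (i + 1) * t.choose 0 : ℝ) * x ^ t = F at h ⊢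
      have : (1 - x) * F = x * ((x / (1 - x)) ^ i / (1 - x)) := by
        push_cast at h; linarith
      rw [← mul_right_inj' h1x, this, pow_succ]
      field_simp
  have sum_zero : ∀ i : ℕ, ∑ n ∈ Finset.range N, (i.choose n * Nat.choose 0 n : ℝ) * (x⁻¹) ^ n = 1 := by
    intro i
    rw [Finset.sum_eq_single_of_mem 0 (Finset.mem_range.2 (by omega))]
    · simp
    · intro n _ hn
      simp [Nat.choose_eq_zero_of_lt (Nat.pos_of_ne_zero hn)]
  induction i generalizing j with
  | zero =>
    have hF := zero_right j
    have hH := sum_zero j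
    simp only [mul_comm (Nat.cast (Nat.choose _ j))] at hF
    simp only [mul_comm (Nat.cast (Nat.choose j _))] at hH
    rw [hF, hH, zero_add, mul_one]
  | succ i ih =>
    induction j with
    | zero => rw [zero_right, sum_zero, add_zero, mul_one]
    | succ j ihj =>
      have h := split (i + 1) (j + 1)
      have e : ∀ t : ℕ, ((t + 1).choose (i + 1) * (t + 1).choose (j + 1) : ℝ) * x ^ (t + 1) =
          x * ((t.choose i * t.choose j : ℝ) * x ^ t) +
          x * ((t.choose i * t.choose (j + 1) : ℝ) * x ^ t) +
          x * ((t.choose (i + 1) * t.choose j : ℝ) * x ^ t) +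
          x * ((t.choose (i + 1) * t.choose (j + 1) : ℝ) * x ^ t) := fun t => by
        simp only [Nat.choose_succ_succ]; push_cast; ring
      have s := fun i j => (hs i j).mul_left x
      simp only [e] at h
      rw [(((s i j).add (s i (j + 1))).add (s (i + 1) j)).tsum_add (s (i + 1) (j + 1)),
        ((s i j).add (s i (j + 1))).tsum_add (s (i + 1) j),
        (s i j).tsum_add (s i (j + 1))] at h
      simp only [tsum_mul_left] at h
      rw [ih j (by omega) (by omega), ih (j + 1) (by omega) hj, ihj (by omega),
        Nat.choose_zero_succ] at h
      rw [sum_choose_mul_choose_succ_succ _ hi]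
      generalize ∑' t : ℕ, (t.choose (i + 1) * t.choose (j + 1) : ℝ) * x ^ t = F at h ⊢
      generalize ∑ n ∈ Finset.range N, (i.choose n * j.choose n : ℝ) * (x⁻¹) ^ n = a at h ⊢
      generalize ∑ n ∈ Finset.range N, (i.choose n * (j + 1).choose n : ℝ) * (x⁻¹) ^ n = b at h ⊢
      generalize ∑ n ∈ Finset.range N, ((i + 1).choose n * j.choose n : ℝ) * (x⁻¹) ^ n = c at h ⊢
      rw [← mul_right_inj' h1x]
      have h' : (1 - x) * F = x * ((x / (1 - x)) ^ (i + j) / (1 - x) * a) +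
          x * ((x / (1 - x)) ^ (i + (j + 1)) / (1 - x) * b) +
          x * ((x / (1 - x)) ^ (i + 1 + j) / (1 - x) * c) := by
        push_cast at h; linarith
      rw [h', show i + (j + 1) = i + j + 1 by ring, show i + 1 + j = i + j + 1 by ring,
        show i + 1 + (j + 1) = i + j + 1 + 1 by ring]
      simp only [pow_succ (x / (1 - x))]
      field_simp

open Finset in
theorem sum_neg_one_pow_mul_choose_mul_choose {R : Type*} [CommRing R] (N n l : ℕ) (hn : n < N) :
    ∑ k ∈ range N, (-1 : R) ^ (n + k) * n.choose k * k.choose l = if n = l then 1 else 0 := by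
  obtain ⟨M, rfl⟩ : ∃ M, N = M + 1 := ⟨N - 1, by omega⟩
  induction n generalizing l with
  | zero =>
    rw [sum_eq_single_of_mem 0 (by simp)]
    · cases l <;> simp
    · intro k _ hk
      simp [Nat.choose_eq_zero_of_lt (Nat.pos_of_ne_zero hk)]
  | succ n ih =>
    have step : ∑ k ∈ range (M + 1), (-1 : R) ^ (n + 1 + k) * (n + 1).choose k * k.choose l =
        ∑ k ∈ range (M + 1), (-1 : R) ^ (n + k) * n.choose k * (k + 1).choose l -
          ∑ k ∈ range (M + 1), (-1 : R) ^ (n + k) * n.choose k * k.choose l := by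
      rw [sum_range_succ' _ M, sum_range_succ _ M, sum_range_succ' _ M,
        Nat.choose_eq_zero_of_lt (by omega : n < M)]
      simp only [Nat.choose_succ_succ n, Nat.choose_zero_right, Nat.cast_add, Nat.cast_zero]
      have : ∀ k, (-1 : R) ^ (n + 1 + (k + 1)) * (n.choose k + n.choose (k + 1)) *
          (k + 1).choose l = (-1 : R) ^ (n + k) * n.choose k * (k + 1).choose l -
            (-1 : R) ^ (n + (k + 1)) * n.choose (k + 1) * (k + 1).choose l := fun k => by ring
      simp only [this, sum_sub_distrib]
      ring
    rw [step, ih l (by omega)]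
    cases l with
    | zero => simpa [sub_eq_zero] using ih 0 (by omega)
    | succ l =>
      simp only [Nat.choose_succ_succ _ l, Nat.cast_add, mul_add, sum_add_distrib]
      rw [ih l (by omega), ih (l + 1) (by omega)]
      simp

/-- The factor `A` in `S(r) = A D Aᵀ`, where `s = r / (1 - r²)`. -/
noncomputable def scaledPascal (m : ℕ) (s : ℝ) : Matrix (Fin m) (Fin m) ℝ :=
  .of fun i n => s ^ (i : ℕ) * (i : ℕ).choose n

/-- The inverse of `scaledPascal m s`. -/
noncomputable def scaledPascalInv (m : ℕ) (s : ℝ) : Matrix (Fin m) (Fin m) ℝ :=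
  .of fun n k => (-1) ^ ((n : ℕ) + k) * (n : ℕ).choose k * (s⁻¹) ^ (k : ℕ)

theorem scaledPascalInv_mul_scaledPascal (m : ℕ) {s : ℝ} (hs : s ≠ 0) :
    scaledPascalInv m s * scaledPascal m s = 1 := by
  ext n l
  rw [Matrix.mul_apply, Matrix.one_apply]
  have e : ∀ k : Fin m, scaledPascalInv m s n k * scaledPascal m s k l =
      (-1) ^ ((n : ℕ) + k) * (n : ℕ).choose k * (k : ℕ).choose l := fun k => by
    have : (s⁻¹) ^ (k : ℕ) * s ^ (k : ℕ) = 1 := by rw [← mul_pow, inv_mul_cancel₀ hs, one_pow]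
    simp only [scaledPascalInv, scaledPascal, Matrix.of_apply]
    linear_combination ((-1) ^ ((n : ℕ) + k) * (n : ℕ).choose k * (k : ℕ).choose l : ℝ) * this
  simp only [e, Fin.ext_iff]
  rw [Fin.sum_univ_eq_sum_range
    (fun k => (-1 : ℝ) ^ ((n : ℕ) + k) * (n : ℕ).choose k * k.choose l) m]
  exact sum_neg_one_pow_mul_choose_mul_choose m n l n.2

theorem Smat_eq_mul (m : ℕ) {r : ℝ} (h0 : 0 < r) (h1 : r < 1) :
    Smat m r = scaledPascal m (r / (1 - r ^ 2)) *
      Matrix.diagonal (fun n : Fin m => ((r ^ 2)⁻¹) ^ (n : ℕ) / (1 - r ^ 2)) *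
      (scaledPascal m (r / (1 - r ^ 2))).transpose := by
  have hx1 : r ^ 2 < 1 := by nlinarith
  have h1x : 1 - r ^ 2 ≠ 0 := by linarith
  ext i j
  rw [Smat]
  simp only [pow_mul]
  rw [tsum_choose_mul_choose_mul_pow (by positivity) hx1 m i j i.2 j.2, Matrix.mul_apply]
  simp only [Matrix.mul_diagonal, Matrix.transpose_apply, scaledPascal, Matrix.of_apply]
  rw [← Fin.sum_univ_eq_sum_range
    (fun n => ((i : ℕ).choose n * (j : ℕ).choose n : ℝ) * ((r ^ 2)⁻¹) ^ n) m,
    mul_div_right_comm, Finset.mul_sum]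
  refine Finset.sum_congr rfl fun n _ => ?_
  have e : (r ^ 2 / (1 - r ^ 2)) ^ ((i : ℕ) + j) =
      r ^ ((i : ℕ) + j) * (r / (1 - r ^ 2)) ^ ((i : ℕ) + j) := by
    rw [← mul_pow]; congr 1; ring
  rw [e, pow_add (r / (1 - r ^ 2))]
  field_simp

theorem Smat_inv_apply_self (m : ℕ) {r : ℝ} (h0 : 0 < r) (h1 : r < 1) (k : Fin m) :
    (Smat m r)⁻¹ k k = ∑ n : Fin m, ((n : ℕ).choose k : ℝ) ^ 2 *
      ((1 - r ^ 2) ^ (2 * (k : ℕ) + 1) * (r ^ (2 * (n : ℕ)) / r ^ (2 * (k : ℕ)))) := by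
  have h1x : 1 - r ^ 2 ≠ 0 := by nlinarith
  have hs : r / (1 - r ^ 2) ≠ 0 := div_ne_zero h0.ne' h1x
  set A := scaledPascal m (r / (1 - r ^ 2)) with hA
  set B := scaledPascalInv m (r / (1 - r ^ 2)) with hB
  set d : Fin m → ℝ := fun n => ((r ^ 2)⁻¹) ^ (n : ℕ) / (1 - r ^ 2) with hd
  have hBA : B * A = 1 := scaledPascalInv_mul_scaledPascal m hs
  have hDD : Matrix.diagonal d⁻¹ * Matrix.diagonal d = 1 := by
    rw [Matrix.diagonal_mul_diagonal, ← Matrix.diagonal_one]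
    congr 1
    funext n
    have : d n ≠ 0 := by simp only [hd]; positivity
    simp [this]
  have hinv : (Smat m r)⁻¹ = B.transpose * Matrix.diagonal d⁻¹ * B := by
    refine Matrix.inv_eq_left_inv ?_
    rw [Smat_eq_mul m h0 h1]
    calc B.transpose * Matrix.diagonal d⁻¹ * B * (A * Matrix.diagonal d * A.transpose)
        = B.transpose * (Matrix.diagonal d⁻¹ * (B * A) * Matrix.diagonal d) * A.transpose := by
          simp only [Matrix.mul_assoc]
      _ = (A * B).transpose := by
          rw [hBA, Matrix.mul_one, hDD, Matrix.mul_one, Matrix.transpose_mul]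
      _ = 1 := by rw [mul_eq_one_comm.1 hBA, Matrix.transpose_one]
  rw [hinv, Matrix.mul_apply]
  refine Finset.sum_congr rfl fun n _ => ?_
  simp only [Matrix.mul_diagonal, Matrix.transpose_apply, hB, scaledPascalInv, Matrix.of_apply,
    Pi.inv_apply, hd, pow_mul, pow_succ _ (2 * (k : ℕ)), inv_pow, inv_div]
  have hsq : ((-1 : ℝ) ^ ((n : ℕ) + k)) * (-1) ^ ((n : ℕ) + k) = 1 := by
    rw [← mul_pow]; simp
  have h2 : ∀ a : ℝ, (a ^ 2) ^ (k : ℕ) = a ^ (k : ℕ) * a ^ (k : ℕ) := fun a => by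
    rw [sq, mul_pow]
  rw [h2, h2, div_pow]
  field_simp
  linear_combination ((n : ℕ).choose k : ℝ) ^ 2 * hsq

/-- For every `m ≥ 1` and `k ∈ {0,…,m-1}` there are `c > 0` and `r₀ ∈ (0,1)`
such that `(S(r)⁻¹)_{kk} ≤ (1-r²)^{2k+1}/c` for all `r ∈ (r₀,1)`. -/
theorem Smat_inv_diag_bound (m : ℕ) (hm : 1 ≤ m) (k : Fin m) :
    ∃ c : ℝ, 0 < c ∧ ∃ r₀ ∈ Set.Ioo (0 : ℝ) 1, ∀ r ∈ Set.Ioo r₀ 1,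
      (Smat m r)⁻¹ k k ≤ (1 - r ^ 2) ^ (2 * (k : ℕ) + 1) / c := by
  have hC : 0 < ∑ n : Fin m, ((n : ℕ).choose k : ℝ) ^ 2 :=
    Finset.sum_pos' (fun n _ => by positivity) ⟨k, Finset.mem_univ k, by simp⟩
  refine ⟨(∑ n : Fin m, ((n : ℕ).choose k : ℝ) ^ 2)⁻¹, inv_pos.2 hC, 1 / 2, by norm_num,
    fun r ⟨hr, h1⟩ => ?_⟩
  have h0 : 0 < r := by linarith
  have hx : 0 < 1 - r ^ 2 := by nlinarith
  rw [Smat_inv_apply_self m h0 h1, div_inv_eq_mul, mul_comm (_ ^ _) (∑ _, _), Finset.sum_mul]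
  refine Finset.sum_le_sum fun n _ => ?_
  rcases lt_or_ge (n : ℕ) k with h | h
  · simp [Nat.choose_eq_zero_of_lt h]
  · refine mul_le_mul_of_nonneg_left (mul_le_of_le_one_right (by positivity) ?_) (by positivity)
    exact div_le_one_of_le₀ (pow_le_pow_of_le_one h0.le h1.le (by omega)) (by positivity)
end

section
/- Let m, n, p be positive integers, let S ∈ ℝ^{m×m} be symmetric positive definite, and let A₀, …, A_{m−1} be complex n×p matrices. Then for every k ∈ {0,…,m−1}, the real part of tr(∑_{i=0}^{m−1} ∑_{j=0}^{m−1} S_{ij} · A_i* A_j) is at least ‖A_k‖_F² / (S⁻¹)_{kk}, where A_i* is the conjugate transpose of A_i and ‖·‖_F is the Frobenius norm. -/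
open Matrix

/-- A positive definite quadratic form dominates each squared coordinate, weighted by the
reciprocal of the corresponding diagonal entry of the inverse matrix. -/
theorem Matrix.PosDef.sq_div_inv_diag_le {ι : Type*} [Fintype ι] [DecidableEq ι]
    {S : Matrix ι ι ℝ} (hS : S.PosDef) (x : ι → ℝ) (k : ι) :
    x k ^ 2 / S⁻¹ k k ≤ x ⬝ᵥ S *ᵥ x := by
  have hd : 0 < S⁻¹ k k := hS.inv.diag_pos
  have hunit : IsUnit S.det := (Matrix.isUnit_iff_isUnit_det S).mp hS.isUnit
  have hST : Sᵀ = S := by simpa using hS.isHermitian.eq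
  set u : ι → ℝ := S⁻¹ *ᵥ Pi.single k 1 with hu
  have hSu : S *ᵥ u = Pi.single k 1 := by
    rw [hu, mulVec_mulVec, mul_nonsing_inv S hunit, one_mulVec]
  have huk : u k = S⁻¹ k k := by simp [hu]
  have hux : u ⬝ᵥ S *ᵥ x = x k := by
    rw [dotProduct_mulVec, ← mulVec_transpose, hST, hSu, single_one_dotProduct]
  have key := hS.posSemidef.dotProduct_mulVec_nonneg (x - (x k / S⁻¹ k k) • u)
  simp only [star_trivial, mulVec_sub, mulVec_smul, hSu, sub_dotProduct, dotProduct_sub,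
    smul_dotProduct, dotProduct_smul, hux, dotProduct_single_one,
    Pi.sub_apply, Pi.smul_apply, huk, smul_eq_mul] at key
  have hcancel : x k / S⁻¹ k k * S⁻¹ k k = x k := div_mul_cancel₀ _ hd.ne'
  rw [hcancel] at key
  have hsq : x k ^ 2 / S⁻¹ k k = x k / S⁻¹ k k * x k := by ring
  linarith

/-- The real part of `tr(∑_{i,j} S_{ij} Aᵢ* Aⱼ)` splits entrywise into values of the quadratic form
of `S` at the real and imaginary parts. -/
theorem re_trace_sum_smul_conjTranspose_mul {ι α β : Type*} [Fintype ι] [Fintype α] [Fintype β]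
    (S : Matrix ι ι ℝ) (A : ι → Matrix α β ℂ) :
    (Matrix.trace (∑ i, ∑ j, ((S i j : ℝ) : ℂ) • ((A i)ᴴ * A j))).re =
      ∑ a, ∑ b, (((fun i => (A i a b).re) ⬝ᵥ S *ᵥ fun i => (A i a b).re) +
        ((fun i => (A i a b).im) ⬝ᵥ S *ᵥ fun i => (A i a b).im)) := by
  have hterm (i j : ι) : (Matrix.trace (((S i j : ℝ) : ℂ) • ((A i)ᴴ * A j))).re =
      ∑ a, ∑ b, ((A i a b).re * (S i j * (A j a b).re) +
        (A i a b).im * (S i j * (A j a b).im)) := by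
    rw [Finset.sum_comm]
    simp only [trace, diag_apply, Matrix.smul_apply, mul_apply, conjTranspose_apply, smul_eq_mul,
      Complex.re_ofReal_mul, Complex.re_sum, Finset.mul_sum]
    refine Finset.sum_congr rfl fun b _ => Finset.sum_congr rfl fun a _ => ?_
    simp only [Complex.mul_re, Complex.star_def, Complex.conj_re, Complex.conj_im]
    ring
  simp only [trace_sum, Complex.re_sum, hterm, dotProduct, mulVec, Finset.mul_sum,
    ← Finset.sum_add_distrib]
  simp_rw [Finset.sum_comm (s := (Finset.univ : Finset ι)) (t := (Finset.univ : Finset α)),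
    Finset.sum_comm (s := (Finset.univ : Finset ι)) (t := (Finset.univ : Finset β))]

/-- For a real symmetric positive definite `S` and complex `n×p` matrices
`A₀,…,A_{m-1}`, the real part of `tr(∑_{i,j} S_{ij} Aᵢ* Aⱼ)` is at least
`‖A_k‖_F² / (S⁻¹)_{kk}` for every `k`. -/
theorem re_trace_quadratic_ge_frobenius_div_inv_diag
    (m n p : ℕ) (hm : 0 < m) (hn : 0 < n) (hp : 0 < p)
    (S : Matrix (Fin m) (Fin m) ℝ) (hS : S.PosDef)
    (A : Fin m → Matrix (Fin n) (Fin p) ℂ) (k : Fin m) :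
    (∑ a : Fin n, ∑ b : Fin p, ‖A k a b‖ ^ 2) / (S⁻¹ k k) ≤
      (Matrix.trace (∑ i : Fin m, ∑ j : Fin m,
        ((S i j : ℝ) : ℂ) • ((A i)ᴴ * A j))).re := by
  rw [re_trace_sum_smul_conjTranspose_mul, Finset.sum_div]
  refine Finset.sum_le_sum fun a _ => ?_
  rw [Finset.sum_div]
  refine Finset.sum_le_sum fun b _ => ?_
  have hnorm : ‖A k a b‖ ^ 2 = (A k a b).re ^ 2 + (A k a b).im ^ 2 := by
    rw [Complex.sq_norm, Complex.normSq_apply]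
    ring
  rw [hnorm, add_div]
  exact add_le_add (hS.sq_div_inv_diag_le (fun i => (A i a b).re) k)
    (hS.sq_div_inv_diag_le (fun i => (A i a b).im) k)
end

section
/- Let A ∈ ℝ^{n×n} be such that every complex eigenvalue of A has modulus strictly less than 1, and let Q ∈ ℝ^{n×n} be symmetric positive semidefinite. Then the series Φ := ∑_{t=0}^∞ (Aᵀ)ᵗ Q Aᵗ converges, Φ is symmetric positive semidefinite, Φ satisfies the Stein (discrete Lyapunov) equation Aᵀ Φ A − Φ + Q = 0, and Φ is the unique real n×n matrix satisfying this equation. -/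
open Matrix

open Filter Topology in
/-- Powers of a Banach algebra element whose spectrum lies in the open unit disc decay
geometrically. -/
theorem exists_eventually_norm_pow_le {B : Type*} [NormedRing B] [NormedAlgebra ℂ B]
    [CompleteSpace B] (a : B) (ha : ∀ z ∈ spectrum ℂ a, ‖z‖ < 1) :
    ∃ r : ℝ, 0 ≤ r ∧ r < 1 ∧ ∀ᶠ k : ℕ in atTop, ‖a ^ k‖ ≤ r ^ k := by
  rcases subsingleton_or_nontrivial B with hB | hB
  · refine ⟨0, le_rfl, one_pos, Eventually.of_forall fun k => ?_⟩
    rw [Subsingleton.elim (a ^ k) 0, norm_zero]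
    positivity
  have hρ : spectralRadius ℂ a < 1 :=
    spectrum.spectralRadius_lt_of_forall_lt a fun z hz => by exact_mod_cast ha z hz
  obtain ⟨r, hr, hr1⟩ := ENNReal.lt_iff_exists_nnreal_btwn.mp hρ
  refine ⟨r, r.2, by exact_mod_cast hr1, ?_⟩
  filter_upwards [(spectrum.pow_nnnorm_pow_one_div_tendsto_nhds_spectralRadius a).eventually_lt_const
    hr, eventually_gt_atTop 0] with k hk hk0
  have hk' : (0 : ℝ) < k := by exact_mod_cast hk0
  rw [one_div, ENNReal.rpow_inv_lt_iff hk', ENNReal.rpow_natCast] at hk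
  exact_mod_cast hk.le

namespace Matrix

section Stein

variable {m : Type*} [Fintype m]

theorem PosSemidef.of_hasSum {ι : Type*} {f : ι → Matrix m m ℝ} {S : Matrix m m ℝ}
    (hf : ∀ i, (f i).PosSemidef) (hS : HasSum f S) : S.PosSemidef := by
  refine .of_dotProduct_mulVec_nonneg ?_ fun x => ?_
  · refine hS.matrix_conjTranspose.unique ?_
    simpa only [(hf _).isHermitian.eq] using hS
  · let q : Matrix m m ℝ →+ ℝ :=
      { toFun := fun M => star x ⬝ᵥ (M *ᵥ x)
        map_zero' := by simp
        map_add' := fun M N => by simp [add_mulVec, dotProduct_add] }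
    have hq : Continuous q :=
      continuous_const.dotProduct (continuous_id.matrix_mulVec continuous_const)
    exact (hS.map q hq).nonneg fun i => (hf i).dotProduct_mulVec_nonneg x

variable [DecidableEq m]

open scoped Matrix.Norms.Frobenius in
theorem summable_transpose_pow_mul_mul_pow {A : Matrix m m ℝ}
    (hA : ∀ μ ∈ spectrum ℂ (A.map Complex.ofReal), ‖μ‖ < 1) (Q : Matrix m m ℝ) :
    Summable fun t : ℕ => Aᵀ ^ t * Q * A ^ t := by
  obtain ⟨r, hr0, hr1, hr⟩ := exists_eventually_norm_pow_le _ hA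
  have hnorm (t : ℕ) : ‖A.map Complex.ofReal ^ t‖ = ‖A ^ t‖ := by
    have hpow : A.map Complex.ofReal ^ t = (A ^ t).map Complex.ofReal :=
      (Matrix.map_pow A Complex.ofRealHom t).symm
    rw [hpow, frobenius_norm_map_eq _ _ Complex.norm_real]
  have hgeom : Summable fun t : ℕ => ‖Q‖ * (r * r) ^ t :=
    (summable_geometric_of_lt_one (by positivity) (by nlinarith)).mul_left _
  refine hgeom.of_norm_bounded_eventually_nat ?_
  filter_upwards [hr] with t ht
  rw [hnorm] at ht
  calc ‖Aᵀ ^ t * Q * A ^ t‖ ≤ ‖Aᵀ ^ t‖ * ‖Q‖ * ‖A ^ t‖ := norm_mul₃_le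
    _ = ‖A ^ t‖ * ‖Q‖ * ‖A ^ t‖ := by rw [← transpose_pow, frobenius_norm_transpose]
    _ ≤ r ^ t * ‖Q‖ * r ^ t := by gcongr
    _ = ‖Q‖ * (r * r) ^ t := by rw [mul_pow]; ring

theorem stein_eq_of_hasSum {A Q Φ : Matrix m m ℝ}
    (hΦ : HasSum (fun t : ℕ => Aᵀ ^ t * Q * A ^ t) Φ) : Aᵀ * Φ * A - Φ + Q = 0 := by
  have hshift : HasSum (fun t : ℕ => Aᵀ ^ (t + 1) * Q * A ^ (t + 1)) (Aᵀ * Φ * A) := by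
    simpa only [pow_succ' Aᵀ, pow_succ A, Matrix.mul_assoc] using (hΦ.mul_left Aᵀ).mul_right A
  have h := hΦ.unique (hshift.zero_add (f := fun t : ℕ => Aᵀ ^ t * Q * A ^ t))
  rw [pow_zero, pow_zero, Matrix.one_mul, Matrix.mul_one] at h
  rw [sub_add_eq_add_sub, sub_eq_zero, add_comm, ← h]

theorem eq_zero_of_transpose_mul_mul_eq_self {A D : Matrix m m ℝ}
    (hA : ∀ μ ∈ spectrum ℂ (A.map Complex.ofReal), ‖μ‖ < 1) (hD : Aᵀ * D * A = D) : D = 0 := by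
  have hpow (t : ℕ) : Aᵀ ^ t * D * A ^ t = D := by
    induction t with
    | zero => simp
    | succ t ih =>
      calc Aᵀ ^ (t + 1) * D * A ^ (t + 1) = Aᵀ ^ t * (Aᵀ * D * A) * A ^ t := by
            simp only [pow_succ Aᵀ, pow_succ' A, Matrix.mul_assoc]
        _ = D := by rw [hD, ih]
  have h := (summable_transpose_pow_mul_mul_pow hA D).tendsto_atTop_zero
  simp only [hpow] at h
  exact tendsto_nhds_unique tendsto_const_nhds h

end Stein

end Matrix

/-- If every complex eigenvalue of `A` has modulus `< 1` and `Q` is symmetric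
positive semidefinite, then `Φ = ∑_{t=0}^∞ (Aᵀ)ᵗ Q Aᵗ` converges, is symmetric
positive semidefinite, solves the Stein equation `Aᵀ Φ A - Φ + Q = 0`, and is
the unique solution of that equation. -/
theorem stein_equation_solution
    (n : ℕ) (A Q : Matrix (Fin n) (Fin n) ℝ)
    (hA : ∀ μ ∈ spectrum ℂ (A.map (Complex.ofReal)), ‖μ‖ < 1)
    (hQ : Q.PosSemidef) :
    ∃ Φ : Matrix (Fin n) (Fin n) ℝ,
      HasSum (fun t : ℕ => (A.transpose) ^ t * Q * A ^ t) Φ ∧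
      Φ.PosSemidef ∧
      A.transpose * Φ * A - Φ + Q = 0 ∧
      ∀ Φ' : Matrix (Fin n) (Fin n) ℝ,
        A.transpose * Φ' * A - Φ' + Q = 0 → Φ' = Φ := by
  obtain ⟨Φ, hΦ⟩ := Matrix.summable_transpose_pow_mul_mul_pow hA Q
  have hstein := Matrix.stein_eq_of_hasSum hΦ
  refine ⟨Φ, hΦ, .of_hasSum (fun t => ?_) hΦ, hstein, fun Φ' hΦ' => ?_⟩
  · simpa using hQ.conjTranspose_mul_mul_same (A ^ t)
  · refine sub_eq_zero.mp (Matrix.eq_zero_of_transpose_mul_mul_eq_self hA ?_)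
    rw [Matrix.mul_sub, Matrix.sub_mul, ← sub_eq_zero, ← sub_eq_zero.mpr (hΦ'.trans hstein.symm)]
    abel
end

section
/- Let K ∈ ℝ^{m×p}, let Γ ∈ ℝ^{p×n} satisfy Γ·Γᵀ = I_p, let R ∈ ℝ^{m×m} be symmetric, let Y ∈ ℝ^{n×n} be symmetric, and let ε > 0 and μ ≥ 0 be reals such that Y − ε·I_n is positive semidefinite and R − μ·I_m is positive semidefinite. Then tr(Γᵀ Kᵀ R K Γ Y) ≥ ε · μ · ‖K‖_F². -/
open Matrix

open scoped ComplexOrder MatrixOrder Matrix.Norms.L2Operator in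
lemma Matrix.PosSemidef.trace_mul_nonneg {ι 𝕜 : Type*} [Fintype ι] [RCLike 𝕜]
    {A B : Matrix ι ι 𝕜} (hA : A.PosSemidef) (hB : B.PosSemidef) : 0 ≤ (A * B).trace := by
  classical
  obtain ⟨C, rfl⟩ := CStarAlgebra.nonneg_iff_eq_star_mul_self.mp hB.nonneg
  rw [← Matrix.mul_assoc, Matrix.trace_mul_comm, ← Matrix.mul_assoc]
  exact (hA.mul_mul_conjTranspose_same C).trace_nonneg

/-- Coercivity lower bound: if `Γ Γᵀ = I`, `Y ⪰ ε I`, and `R ⪰ μ I`, then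
`tr(Γᵀ Kᵀ R K Γ Y) ≥ ε μ ‖K‖_F²`. -/
theorem trace_quadratic_ge_coercive
    (m p n : ℕ) (K : Matrix (Fin m) (Fin p) ℝ) (Γ : Matrix (Fin p) (Fin n) ℝ)
    (R : Matrix (Fin m) (Fin m) ℝ) (Y : Matrix (Fin n) (Fin n) ℝ)
    (ε μ : ℝ) (hε : 0 < ε) (hμ : 0 ≤ μ)
    (hΓ : Γ * Γ.transpose = 1)
    (hR : R.IsSymm) (hY : Y.IsSymm)
    (hYε : (Y - ε • (1 : Matrix (Fin n) (Fin n) ℝ)).PosSemidef)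
    (hRμ : (R - μ • (1 : Matrix (Fin m) (Fin m) ℝ)).PosSemidef) :
    ε * μ * Matrix.trace (K * K.transpose) ≤
      Matrix.trace (Γ.transpose * K.transpose * R * K * Γ * Y) := by
  have hY_psd : Y.PosSemidef := by
    simpa using hYε.add (PosSemidef.one.smul hε.le)
  have hM : K * Γ * (K * Γ)ᵀ = K * Kᵀ := by
    rw [transpose_mul, Matrix.mul_assoc, ← Matrix.mul_assoc Γ, hΓ, Matrix.one_mul]
  have h₁ : 0 ≤ (K * Γ * Y * (K * Γ)ᵀ).trace - ε * (K * Kᵀ).trace := by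
    have h := (hYε.mul_mul_conjTranspose_same (K * Γ)).trace_nonneg
    simpa only [conjTranspose_eq_transpose_of_trivial, Matrix.mul_sub, Matrix.sub_mul,
      Matrix.mul_smul, Matrix.smul_mul, Matrix.mul_one, hM, trace_sub, trace_smul,
      smul_eq_mul] using h
  have h₂ : 0 ≤ (R * (K * Γ * Y * (K * Γ)ᵀ)).trace - μ * (K * Γ * Y * (K * Γ)ᵀ).trace := by
    have h := hRμ.trace_mul_nonneg (hY_psd.mul_mul_conjTranspose_same (K * Γ))
    simpa only [conjTranspose_eq_transpose_of_trivial, Matrix.sub_mul, Matrix.smul_mul,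
      Matrix.one_mul, trace_sub, trace_smul, smul_eq_mul] using h
  have h₃ : (Γᵀ * Kᵀ * R * K * Γ * Y).trace = (R * (K * Γ * Y * (K * Γ)ᵀ)).trace := by
    rw [← Matrix.mul_assoc, trace_mul_comm _ (K * Γ)ᵀ, transpose_mul]
    simp only [Matrix.mul_assoc]
  rw [h₃]
  nlinarith [mul_nonneg hμ h₁]
end

section
/- Let A ∈ ℝ^{n×n}, B ∈ ℝ^{n×m}, C ∈ ℝ^{p×n}, let L ≥ 1, and let sequences x : ℕ → ℝⁿ, u : ℕ → ℝᵐ, w : ℕ → ℝⁿ, y : ℕ → ℝᵖ, v : ℕ → ℝᵖ satisfy x(t+1) = A x(t) + B u(t) + w(t) and y(t) = C x(t) + v(t) for all t ≥ 0. Suppose O⁺ is a left inverse of the observability matrix 𝒪_L(A,C), i.e. O⁺ · 𝒪_L(A,C) = I_n. Define M₁ := ℛ_L(A,B) − A^L O⁺ ℋ_L(A,B,C), M₂ := A^L O⁺, M₃ := ℛ_L(A,I) − A^L O⁺ ℋ_L(A,I,C), M₄ := −A^L O⁺. Then for every t ≥ L: x(t) = M₁·U_t + M₂·Y_t + M₃·W_t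 + M₄·V_t, and consequently y(t) = C(M₁·U_t + M₂·Y_t + M₃·W_t + M₄·V_t) + v(t), where U_t := [u(t−L); u(t−L+1); …; u(t−1)] is the stacked column vector of the last L inputs, and Y_t, W_t, V_t are defined analogously from y, w, v. -/
open Matrix

namespace IOH

variable {n m p : ℕ}

/-- Block reachability matrix `ℛ_L(A,B) = [A^{L-1}B, …, AB, B]`,
with block columns indexed by `Fin L`. -/
noncomputable def reachMat (L : ℕ) (A : Matrix (Fin n) (Fin n) ℝ)
    (B : Matrix (Fin n) (Fin m) ℝ) : Matrix (Fin n) (Fin L × Fin m) ℝ :=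
  fun i lj => (A ^ (L - 1 - (lj.1 : ℕ)) * B) i lj.2

/-- Block observability matrix `𝒪_L(A,C) = [C; CA; …; CA^{L-1}]`,
with block rows indexed by `Fin L`. -/
noncomputable def obsMat (L : ℕ) (A : Matrix (Fin n) (Fin n) ℝ)
    (C : Matrix (Fin p) (Fin n) ℝ) : Matrix (Fin L × Fin p) (Fin n) ℝ :=
  fun li j => (C * A ^ ((li.1 : ℕ))) li.2 j

/-- Block Toeplitz (Markov-parameter) matrix `ℋ_L(A,B,C)`: the `(i,j)`-th
`p×m` block (0-based) is `0` if `i ≤ j` and `C A^{i-j-1} B` if `i > j`. -/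
noncomputable def hankMat (L : ℕ) (A : Matrix (Fin n) (Fin n) ℝ)
    (B : Matrix (Fin n) (Fin m) ℝ) (C : Matrix (Fin p) (Fin n) ℝ) :
    Matrix (Fin L × Fin p) (Fin L × Fin m) ℝ :=
  fun ia jb =>
    if (jb.1 : ℕ) < (ia.1 : ℕ) then
      (C * A ^ ((ia.1 : ℕ) - (jb.1 : ℕ) - 1) * B) ia.2 jb.2
    else 0

/-- Stacked column vector `[u(t-L); u(t-L+1); …; u(t-1)]` of the last `L`
values of the signal `u`. -/
def stack {d : ℕ} (L : ℕ) (u : ℕ → Fin d → ℝ) (t : ℕ) : Fin L × Fin d → ℝ :=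
  fun lj => u (t - L + (lj.1 : ℕ)) lj.2

end IOH

open IOH

namespace IOH

variable {n m p : ℕ}

lemma reachMat_mulVec_stack (L : ℕ) (A : Matrix (Fin n) (Fin n) ℝ)
    (B : Matrix (Fin n) (Fin m) ℝ) (u : ℕ → Fin m → ℝ) (t : ℕ) :
    reachMat L A B *ᵥ stack L u t =
      ∑ j ∈ Finset.range L, (A ^ (L - 1 - j) * B) *ᵥ u (t - L + j) := by
  ext i
  rw [Finset.sum_range (fun j => (A ^ (L - 1 - j) * B) *ᵥ u (t - L + j)), Finset.sum_apply]
  simp only [mulVec, dotProduct, Fintype.sum_prod_type, reachMat, stack]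

lemma obsMat_mulVec_apply (L : ℕ) (A : Matrix (Fin n) (Fin n) ℝ)
    (C : Matrix (Fin p) (Fin n) ℝ) (z : Fin n → ℝ) (i : Fin L) (a : Fin p) :
    (obsMat L A C *ᵥ z) (i, a) = (C *ᵥ (A ^ (i : ℕ) *ᵥ z)) a := by
  rw [mulVec_mulVec]
  rfl

lemma hankMat_mulVec_stack_apply (L : ℕ) (A : Matrix (Fin n) (Fin n) ℝ)
    (B : Matrix (Fin n) (Fin m) ℝ) (C : Matrix (Fin p) (Fin n) ℝ) (u : ℕ → Fin m → ℝ)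
    (t : ℕ) (i : Fin L) (a : Fin p) :
    (hankMat L A B C *ᵥ stack L u t) (i, a) =
      (C *ᵥ ∑ j ∈ Finset.range i, (A ^ ((i : ℕ) - 1 - j) * B) *ᵥ u (t - L + j)) a := by
  have hsub : Finset.range i = {j ∈ Finset.range L | j < (i : ℕ)} := by
    ext j
    have := i.isLt
    simp only [Finset.mem_range, Finset.mem_filter]
    omega
  rw [mulVec_sum, Finset.sum_apply, hsub, Finset.sum_filter, Finset.sum_range]
  simp only [mulVec_mulVec]
  simp only [mulVec, dotProduct, Fintype.sum_prod_type, hankMat, stack]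
  refine Finset.sum_congr rfl fun j _ => ?_
  split_ifs
  · rw [Nat.sub_right_comm, Matrix.mul_assoc]
  · simp

lemma sum_range_succ_pow_mul (A : Matrix (Fin n) (Fin n) ℝ) (B : Matrix (Fin n) (Fin m) ℝ)
    (f : ℕ → Fin m → ℝ) (k : ℕ) :
    ∑ j ∈ Finset.range (k + 1), (A ^ (k + 1 - 1 - j) * B) *ᵥ f j =
      A *ᵥ (∑ j ∈ Finset.range k, (A ^ (k - 1 - j) * B) *ᵥ f j) + B *ᵥ f k := by
  rw [Finset.sum_range_succ, mulVec_sum]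
  congr 1
  · refine Finset.sum_congr rfl fun j hj => ?_
    have hk : k + 1 - 1 - j = k - 1 - j + 1 := by
      have := Finset.mem_range.mp hj
      omega
    rw [hk, mulVec_mulVec, ← Matrix.mul_assoc, pow_succ']
  · simp

/-- Variation of constants for a discrete-time linear system with input `u` and disturbance `w`. -/
lemma state_add (A : Matrix (Fin n) (Fin n) ℝ) (B : Matrix (Fin n) (Fin m) ℝ)
    (x w : ℕ → Fin n → ℝ) (u : ℕ → Fin m → ℝ)
    (hdyn : ∀ t, x (t + 1) = A *ᵥ x t + B *ᵥ u t + w t) (s k : ℕ) :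
    x (s + k) = A ^ k *ᵥ x s +
      ∑ j ∈ Finset.range k, (A ^ (k - 1 - j) * B) *ᵥ u (s + j) +
      ∑ j ∈ Finset.range k, (A ^ (k - 1 - j) * 1) *ᵥ w (s + j) := by
  induction k with
  | zero => simp
  | succ k ih =>
    rw [sum_range_succ_pow_mul A B (fun j => u (s + j)),
      sum_range_succ_pow_mul A 1 (fun j => w (s + j)), ← add_assoc, hdyn, ih, pow_succ',
      ← mulVec_mulVec, mulVec_add, mulVec_add, one_mulVec]
    abel

/-- The stacked output history in terms of the state at the start of the window. -/
lemma stack_output (A : Matrix (Fin n) (Fin n) ℝ) (B : Matrix (Fin n) (Fin m) ℝ)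
    (C : Matrix (Fin p) (Fin n) ℝ) (L : ℕ)
    (x w : ℕ → Fin n → ℝ) (u : ℕ → Fin m → ℝ) (y v : ℕ → Fin p → ℝ)
    (hdyn : ∀ t, x (t + 1) = A *ᵥ x t + B *ᵥ u t + w t)
    (hout : ∀ t, y t = C *ᵥ x t + v t) (t : ℕ) :
    stack L y t = obsMat L A C *ᵥ x (t - L) + hankMat L A B C *ᵥ stack L u t +
      hankMat L A 1 C *ᵥ stack L w t + stack L v t := by
  ext ⟨i, a⟩
  simp only [Pi.add_apply, obsMat_mulVec_apply, hankMat_mulVec_stack_apply]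
  simp only [stack, hout, state_add A B x w u hdyn (t - L) i, mulVec_add, Pi.add_apply]

end IOH

/-- State reconstruction from the input–output history: under the linear
dynamics `x(t+1) = Ax(t) + Bu(t) + w(t)`, `y(t) = Cx(t) + v(t)`, with `O⁺` a
left inverse of `𝒪_L(A,C)`, for every `t ≥ L` the state satisfies
`x(t) = M₁ U_t + M₂ Y_t + M₃ W_t + M₄ V_t`, and consequently
`y(t) = C(M₁ U_t + M₂ Y_t + M₃ W_t + M₄ V_t) + v(t)`. -/
theorem ioh_state_reconstruction
    {n m p : ℕ} (A : Matrix (Fin n) (Fin n) ℝ) (B : Matrix (Fin n) (Fin m) ℝ)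
    (C : Matrix (Fin p) (Fin n) ℝ) (L : ℕ) (hL : 1 ≤ L)
    (x w : ℕ → Fin n → ℝ) (u : ℕ → Fin m → ℝ) (y v : ℕ → Fin p → ℝ)
    (hdyn : ∀ t : ℕ, x (t + 1) = A.mulVec (x t) + B.mulVec (u t) + w t)
    (hout : ∀ t : ℕ, y t = C.mulVec (x t) + v t)
    (Oplus : Matrix (Fin n) (Fin L × Fin p) ℝ)
    (hOplus : Oplus * obsMat L A C = 1) :
    ∀ t : ℕ, L ≤ t →
      (x t =
          (reachMat L A B - A ^ L * Oplus * hankMat L A B C).mulVec (stack L u t) +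
          (A ^ L * Oplus).mulVec (stack L y t) +
          (reachMat L A 1 - A ^ L * Oplus * hankMat L A 1 C).mulVec (stack L w t) +
          (-(A ^ L * Oplus)).mulVec (stack L v t)) ∧
        y t =
          C.mulVec
            ((reachMat L A B - A ^ L * Oplus * hankMat L A B C).mulVec (stack L u t) +
             (A ^ L * Oplus).mulVec (stack L y t) +
             (reachMat L A 1 - A ^ L * Oplus * hankMat L A 1 C).mulVec (stack L w t) +
             (-(A ^ L * Oplus)).mulVec (stack L v t)) + v t := by
  intro t ht
  have hx : x t = (A ^ L) *ᵥ x (t - L) + reachMat L A B *ᵥ stack L u t +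
      reachMat L A 1 *ᵥ stack L w t := by
    have h := state_add A B x w u hdyn (t - L) L
    rwa [Nat.sub_add_cancel ht, ← reachMat_mulVec_stack, ← reachMat_mulVec_stack] at h
  have hinv : (A ^ L * Oplus) *ᵥ (obsMat L A C *ᵥ x (t - L)) = (A ^ L) *ᵥ x (t - L) := by
    rw [mulVec_mulVec, Matrix.mul_assoc, hOplus, Matrix.mul_one]
  have hstate : x t =
      (reachMat L A B - A ^ L * Oplus * hankMat L A B C).mulVec (stack L u t) +
      (A ^ L * Oplus).mulVec (stack L y t) +
      (reachMat L A 1 - A ^ L * Oplus * hankMat L A 1 C).mulVec (stack L w t) +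
      (-(A ^ L * Oplus)).mulVec (stack L v t) := by
    rw [stack_output A B C L x w u y v hdyn hout t, hx]
    simp only [mulVec_add, sub_mulVec, neg_mulVec, hinv, ← mulVec_mulVec _ (A ^ L * Oplus)]
    abel
  exact ⟨hstate, hstate ▸ hout t⟩
end

section
/- Let L ≥ 1 and n ≥ 1 be integers and let K₁, …, K_L ∈ ℝ^{n×n} be arbitrary. Define the block matrices G ∈ ℝ^{Ln×Ln} and F ∈ ℝ^{n×Ln} by: the (i,j)-th n×n block of G (blocks indexed 1,…,L) equals K_{L−i+1} if j = L, equals I_n if i ≥ 2 and j = i−1, and 0 otherwise; and F = [0, …, 0, I_n] (the last block). Then the observability matrix 𝒪_L(G,F) := [F; FG; …; FG^{L−1}] ∈ ℝ^{Ln×Ln} is invertible. -/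
open Matrix

/-- A row `F` selecting the last block reads off the last block of a vector. -/
lemma mulVec_of_last_block {L n : ℕ} (hL : 1 ≤ L)
    {F : Matrix (Fin n) (Fin L × Fin n) ℝ}
    (hF : ∀ (a : Fin n) (j : Fin L) (b : Fin n),
      F a (j, b) = if (j : ℕ) = L - 1 ∧ a = b then 1 else 0)
    (w : Fin L × Fin n → ℝ) (a : Fin n) :
    (F *ᵥ w) a = w (⟨L - 1, by omega⟩, a) := by
  simp only [Matrix.mulVec, dotProduct]
  rw [Fintype.sum_eq_single (⟨L - 1, by omega⟩, a)]
  · simp [hF]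
  · rintro ⟨j, b⟩ h
    rw [hF, if_neg, zero_mul]
    rintro ⟨hj, rfl⟩
    exact h (Prod.ext (Fin.ext hj) rfl)

/-- The block-companion matrix shifts down the blocks of a vector whose last block vanishes. -/
lemma companion_mulVec_succ {L n : ℕ}
    {K : Fin L → Matrix (Fin n) (Fin n) ℝ}
    {G : Matrix (Fin L × Fin n) (Fin L × Fin n) ℝ}
    (hG : ∀ (i j : Fin L) (a b : Fin n),
      G (i, a) (j, b) =
        if (j : ℕ) = L - 1 then K i.rev a b
        else if (i : ℕ) = (j : ℕ) + 1 ∧ a = b then 1 else 0)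
    {w : Fin L × Fin n → ℝ}
    (hw : ∀ (j : Fin L) (b : Fin n), (j : ℕ) = L - 1 → w (j, b) = 0)
    {i : ℕ} (hi : i + 1 < L) (a : Fin n) :
    (G *ᵥ w) (⟨i + 1, hi⟩, a) = w (⟨i, by omega⟩, a) := by
  simp only [Matrix.mulVec, dotProduct]
  rw [Fintype.sum_eq_single (⟨i, by omega⟩, a)]
  · rw [hG, if_neg (by simp only; omega)]
    simp
  · rintro ⟨j, b⟩ h
    by_cases hj : (j : ℕ) = L - 1
    · rw [hw j b hj, mul_zero]
    · rw [hG, if_neg hj, if_neg, zero_mul]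
      rintro ⟨hij, rfl⟩
      exact h (Prod.ext (Fin.ext (by simp only at hij ⊢; omega)) rfl)

/-- Invertibility of the observability matrix of the block-companion
realization: for arbitrary `K₁,…,K_L ∈ ℝ^{n×n}`, with
`G` the block-companion matrix whose `(i,j)`-th `n×n` block (1-based) is
`K_{L-i+1}` if `j = L`, `I` if `i ≥ 2, j = i-1`, and `0` otherwise, and
`F = [0,…,0,I]`, the matrix `𝒪_L(G,F) = [F; FG; …; FG^{L-1}]` is invertible. -/
theorem obsMat_companion_isUnit
    (L n : ℕ) (hL : 1 ≤ L) (hn : 1 ≤ n)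
    (K : Fin L → Matrix (Fin n) (Fin n) ℝ)
    (G : Matrix (Fin L × Fin n) (Fin L × Fin n) ℝ)
    (F : Matrix (Fin n) (Fin L × Fin n) ℝ)
    (hG : ∀ (i j : Fin L) (a b : Fin n),
      G (i, a) (j, b) =
        if (j : ℕ) = L - 1 then K i.rev a b
        else if (i : ℕ) = (j : ℕ) + 1 ∧ a = b then 1 else 0)
    (hF : ∀ (a : Fin n) (j : Fin L) (b : Fin n),
      F a (j, b) = if (j : ℕ) = L - 1 ∧ a = b then 1 else 0) :
    IsUnit (Matrix.of (fun (la : Fin L × Fin n) (q : Fin L × Fin n) =>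
      (F * G ^ ((la.1 : ℕ))) la.2 q)) := by
  rw [← Matrix.mulVec_injective_iff_isUnit]
  refine (injective_iff_map_eq_zero (Matrix.mulVecLin _)).2 fun v hv ↦ ?_
  have hlast : ∀ l < L, ∀ a, (G ^ l *ᵥ v) (⟨L - 1, by omega⟩, a) = 0 := by
    intro l hl a
    rw [← mulVec_of_last_block hL hF (G ^ l *ᵥ v), Matrix.mulVec_mulVec]
    exact congrFun hv (⟨l, hl⟩, a)
  have hshift : ∀ l i (h : i + l < L) a,
      (G ^ l *ᵥ v) (⟨i + l, h⟩, a) = v (⟨i, by omega⟩, a) := by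
    intro l
    induction l with
    | zero => simp
    | succ l ih =>
      intro i h a
      rw [pow_succ', ← Matrix.mulVec_mulVec, ← ih i (by omega) a]
      refine companion_mulVec_succ hG (fun j b hj ↦ ?_) (i := i + l) h a
      rw [show j = ⟨L - 1, by omega⟩ from Fin.ext hj]
      exact hlast l (by omega) b
  ext ⟨⟨i, hi⟩, a⟩
  rw [← hshift (L - 1 - i) i (by omega) a, Pi.zero_apply, ← hlast (L - 1 - i) (by omega) a]
  congr 3
  omega
end
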